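/- arXiv:math/0510202 — 5 statements merged into one kernel-verified Lean document; each statement's English description precedes it below -/
import Mathlib

section
/- Let Z ↦ J_Z be an H-type structure on ℝ^k, let V ∈ ℝ^l be nonzero with V_u = V/‖V‖, and let Q ∈ ℝ^k. Then the function Θ_Q(·, V_u) on ℝ^k is an eigenfunction of the angular-momentum directional derivative D_V with purely imaginary eigenvalue: (D_V Θ_Q(·,V_u))(X) = i‖V‖·Θ_Q(X, V_u) for all X, and its complex conjugate satisfies (D_V Θ̄_Q(·,V_u))(X) = −i‖V‖·Θ̄_Q(X, V_u). -/
open scoped RealInnerProductSpace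
open MeasureTheory

noncomputable section

/-- An H-type (Heisenberg-type) structure on `ℝ^k` with center `ℝ^l`: a linear map
`Z ↦ J_Z` into skew-symmetric endomorphisms of `ℝ^k` satisfying the Clifford condition
`J_Z ∘ J_Z = -‖Z‖² • id`. -/
structure HType (k l : ℕ) where
  J : EuclideanSpace ℝ (Fin l) →ₗ[ℝ] EuclideanSpace ℝ (Fin k) →ₗ[ℝ] EuclideanSpace ℝ (Fin k)
  skew : ∀ (Z : EuclideanSpace ℝ (Fin l)) (X Y : EuclideanSpace ℝ (Fin k)),
    ⟪J Z X, Y⟫ = -⟪X, J Z Y⟫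
  clifford : ∀ (Z : EuclideanSpace ℝ (Fin l)) (X : EuclideanSpace ℝ (Fin k)),
    J Z (J Z X) = -(‖Z‖ ^ 2) • X
/-- The complex-valued linear function `Θ_Q(X, V_u) = ⟨Q,X⟩ + i⟨J_{V_u}(Q),X⟩`. -/
def Theta {k l : ℕ} (H : HType k l) (Q : EuclideanSpace ℝ (Fin k))
    (Vu : EuclideanSpace ℝ (Fin l)) (X : EuclideanSpace ℝ (Fin k)) : ℂ :=
  ((⟪Q, X⟫ : ℝ) : ℂ) + Complex.I * ((⟪H.J Vu Q, X⟫ : ℝ) : ℂ)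

/-- `Θ_Q(·,V_u)` as a continuous `ℝ`-linear map. -/
def thetaCLM {k l : ℕ} (H : HType k l) (Q : EuclideanSpace ℝ (Fin k))
    (Vu : EuclideanSpace ℝ (Fin l)) : EuclideanSpace ℝ (Fin k) →L[ℝ] ℂ :=
  Complex.ofRealCLM.comp (innerSL ℝ Q) +
    Complex.I • Complex.ofRealCLM.comp (innerSL ℝ (H.J Vu Q))

theorem thetaCLM_apply {k l : ℕ} (H : HType k l) (Q : EuclideanSpace ℝ (Fin k))
    (Vu : EuclideanSpace ℝ (Fin l)) (X : EuclideanSpace ℝ (Fin k)) :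
    thetaCLM H Q Vu X = Theta H Q Vu X := by
  simp [thetaCLM, Theta]

theorem hasFDerivAt_Theta {k l : ℕ} (H : HType k l) (Q : EuclideanSpace ℝ (Fin k))
    (Vu : EuclideanSpace ℝ (Fin l)) (X : EuclideanSpace ℝ (Fin k)) :
    HasFDerivAt (fun Y => Theta H Q Vu Y) (thetaCLM H Q Vu) X := by
  simp only [← thetaCLM_apply]
  exact (thetaCLM H Q Vu).hasFDerivAt

theorem Theta_J_apply {k l : ℕ} (H : HType k l)
    (V : EuclideanSpace ℝ (Fin l)) (hV : V ≠ 0) (Q X : EuclideanSpace ℝ (Fin k)) :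
    Theta H Q (‖V‖⁻¹ • V) (H.J V X)
      = (Complex.I * (‖V‖ : ℂ)) * Theta H Q (‖V‖⁻¹ • V) X := by
  have hn : ‖V‖ ≠ 0 := norm_ne_zero_iff.mpr hV
  have hnc : (‖V‖ : ℂ) ≠ 0 := Complex.ofReal_ne_zero.mpr hn
  have hQ : ⟪Q, H.J V X⟫ = -⟪H.J V Q, X⟫ := by rw [H.skew, neg_neg]
  have hJQ : ⟪H.J V Q, H.J V X⟫ = ‖V‖ ^ 2 * ⟪Q, X⟫ := by
    rw [← neg_inj, ← H.skew, H.clifford, real_inner_smul_left, neg_mul]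
  simp only [Theta, map_smul, LinearMap.smul_apply, real_inner_smul_left, hQ, hJQ]
  push_cast
  field_simp
  linear_combination (-(⟪H.J V Q, X⟫ : ℂ)) * Complex.I_sq

/-- `Θ_Q(·,V_u)` is an eigenfunction of the angular-momentum directional derivative
`D_V f (X) = Df(X)(J_V(X))` with eigenvalue `i‖V‖`, and its conjugate has
eigenvalue `-i‖V‖`. -/
theorem theta_eigenfunction_angular_momentum {k l : ℕ} (H : HType k l)
    (V : EuclideanSpace ℝ (Fin l)) (hV : V ≠ 0)
    (Q X : EuclideanSpace ℝ (Fin k)) :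
    fderiv ℝ (fun Y => Theta H Q (‖V‖⁻¹ • V) Y) X (H.J V X)
      = (Complex.I * (‖V‖ : ℂ)) * Theta H Q (‖V‖⁻¹ • V) X ∧
    fderiv ℝ (fun Y => (starRingEnd ℂ) (Theta H Q (‖V‖⁻¹ • V) Y)) X (H.J V X)
      = (-(Complex.I * (‖V‖ : ℂ))) * (starRingEnd ℂ) (Theta H Q (‖V‖⁻¹ • V) X) := by
  have hΘ := hasFDerivAt_Theta H Q (‖V‖⁻¹ • V) X
  have hconj := (Complex.conjCLE : ℂ →L[ℝ] ℂ).hasFDerivAt.comp X hΘ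
  have key := Theta_J_apply H V hV Q X
  constructor
  · rw [hΘ.fderiv, thetaCLM_apply, key]
  · refine (congrArg (fun L => L (H.J V X)) hconj.fderiv).trans ?_
    simp [thetaCLM_apply, key]
end
end

section
/- Let Z ↦ J_Z be an H-type structure on ℝ^k, let V ∈ ℝ^l be nonzero with V_u = V/‖V‖, let Q ∈ ℝ^k, and let p, q be natural numbers. Then the function X ↦ Θ_Q(X,V_u)^p · Θ̄_Q(X,V_u)^q is an eigenfunction of the angular-momentum directional derivative D_V with eigenvalue i(p−q)‖V‖, i.e. D_V(Θ_Q^p Θ̄_Q^q)(X) = i(p−q)‖V‖ · Θ_Q(X,V_u)^p Θ̄_Q(X,V_u)^q for all X ∈ ℝ^k. -/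
open scoped RealInnerProductSpace
open MeasureTheory

noncomputable section

theorem theta_J_apply {k l : ℕ} (H : HType k l) {V : EuclideanSpace ℝ (Fin l)} (hV : V ≠ 0)
    (Q X : EuclideanSpace ℝ (Fin k)) :
    Theta H Q (‖V‖⁻¹ • V) (H.J V X) =
      Complex.I * (‖V‖ : ℂ) * Theta H Q (‖V‖⁻¹ • V) X := by
  have hn : ‖V‖ ≠ 0 := norm_ne_zero_iff.mpr hV
  have hQ : ⟪Q, H.J V X⟫ = -(‖V‖ * ⟪H.J (‖V‖⁻¹ • V) Q, X⟫) := by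
    rw [map_smul, LinearMap.smul_apply, real_inner_smul_left, mul_inv_cancel_left₀ hn, H.skew,
      neg_neg]
  have hJQ : ⟪H.J (‖V‖⁻¹ • V) Q, H.J V X⟫ = ‖V‖ * ⟪Q, X⟫ := by
    rw [map_smul, LinearMap.smul_apply, real_inner_smul_left, H.skew, H.clifford,
      real_inner_smul_right]
    field_simp
  rw [Theta, Theta, hQ, hJQ]
  push_cast
  linear_combination -(‖V‖ : ℂ) * (⟪H.J (‖V‖⁻¹ • V) Q, X⟫ : ℝ) * Complex.I_mul_I

/-- `Θ_Q^p · Θ̄_Q^q` is an eigenfunction of the angular-momentum directional derivative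
`D_V f (X) = Df(X)(J_V(X))` with eigenvalue `i(p-q)‖V‖`. -/
theorem theta_pow_eigenfunction_angular_momentum {k l : ℕ} (H : HType k l)
    (V : EuclideanSpace ℝ (Fin l)) (hV : V ≠ 0)
    (Q : EuclideanSpace ℝ (Fin k)) (p q : ℕ) (X : EuclideanSpace ℝ (Fin k)) :
    fderiv ℝ
        (fun Y => Theta H Q (‖V‖⁻¹ • V) Y ^ p *
          ((starRingEnd ℂ) (Theta H Q (‖V‖⁻¹ • V) Y)) ^ q) X (H.J V X)
      = Complex.I * ((p : ℂ) - (q : ℂ)) * (‖V‖ : ℂ) *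
          (Theta H Q (‖V‖⁻¹ • V) X ^ p *
            ((starRingEnd ℂ) (Theta H Q (‖V‖⁻¹ • V) X)) ^ q) := by
  have hd : HasFDerivAt (Theta H Q (‖V‖⁻¹ • V)) (thetaCLM H Q (‖V‖⁻¹ • V)) X :=
    (thetaCLM H Q (‖V‖⁻¹ • V)).hasFDerivAt.congr_of_eventuallyEq
      (.of_forall fun Y => (thetaCLM_apply H Q _ Y).symm)
  have hc : HasFDerivAt (fun Y => (starRingEnd ℂ) (Theta H Q (‖V‖⁻¹ • V) Y))
      ((Complex.conjCLE : ℂ →L[ℝ] ℂ).comp (thetaCLM H Q (‖V‖⁻¹ • V))) X :=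
    (Complex.conjCLE : ℂ →L[ℝ] ℂ).hasFDerivAt.comp X hd
  rw [((hd.pow p).fun_mul (hc.pow q)).fderiv]
  simp only [add_apply, smul_apply, ContinuousLinearMap.comp_apply,
    ContinuousLinearEquiv.coe_coe, Complex.conjCLE_apply, thetaCLM_apply, theta_J_apply H hV,
    map_mul, Complex.conj_I, Complex.conj_ofReal, smul_eq_mul, nsmul_eq_mul]
  rcases p with _ | p <;> rcases q with _ | q <;> simp <;> ring
end
end

section
/- Let Z ↦ J_Z be an H-type structure on ℝ^k, Q ∈ ℝ^k, p, q natural numbers, and φ: ℝ^l → ℂ continuous with compact support. Define F(X, Z) := ∫_{ℝ^l} e^{i⟨Z,V⟩} φ(V) Θ_Q(X, V/‖V‖)^p Θ̄_Q(X, V/‖V‖)^q dV, and let ℳ denote the compound angular momentum operator (ℳ f)(X,Z) := ∑_{α=1}^l ∂_{Z_α}(D_α f)(X, Z), where (D_α f)(X,Z) := D_X f(X,Z)(J_{e_α}(X)) for the standard basis e_1,…,e_l of ℝ^l. Then ℳ F(X, Z) = ∫_{ℝ^l} e^{i⟨Z,V⟩} (q−p)‖V‖ φ(V) Θ_Q(X,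 V/‖V‖)^p Θ̄_Q(X, V/‖V‖)^q dV, i.e. ℳ applied to the twisted Z-Fourier transform of φ equals the twisted Z-Fourier transform of (q−p)‖V‖φ. -/
open scoped RealInnerProductSpace
open MeasureTheory

noncomputable section

/-- The Euclidean Laplacian of a function on `ℝ^k`, as the sum of second directional
derivatives along the standard orthonormal basis. -/
def lapE {k : ℕ} (ψ : EuclideanSpace ℝ (Fin k) → ℂ) (X : EuclideanSpace ℝ (Fin k)) : ℂ :=
  ∑ i : Fin k,
    fderiv ℝ (fun Y => fderiv ℝ ψ Y (EuclideanSpace.single i (1 : ℝ))) X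
      (EuclideanSpace.single i (1 : ℝ))

/-- The Laplacian `Δ_X` in the `X`-variable of a function on `ℝ^k × ℝ^l`. -/
def lapX {k l : ℕ} (f : EuclideanSpace ℝ (Fin k) × EuclideanSpace ℝ (Fin l) → ℂ)
    (p : EuclideanSpace ℝ (Fin k) × EuclideanSpace ℝ (Fin l)) : ℂ :=
  lapE (fun X => f (X, p.2)) p.1

/-- The Laplacian `Δ_Z` in the `Z`-variable of a function on `ℝ^k × ℝ^l`. -/
def lapZ {k l : ℕ} (f : EuclideanSpace ℝ (Fin k) × EuclideanSpace ℝ (Fin l) → ℂ)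
    (p : EuclideanSpace ℝ (Fin k) × EuclideanSpace ℝ (Fin l)) : ℂ :=
  lapE (fun Z => f (p.1, Z)) p.2

/-- The directional derivative `D_α f (X,Z) = D_X f(X,Z)(J_{e_α}(X))` along the vector
field `X ↦ J_{e_α}(X)`, for the standard basis vector `e_α` of `ℝ^l`. -/
def Dop {k l : ℕ} (H : HType k l) (α : Fin l)
    (f : EuclideanSpace ℝ (Fin k) × EuclideanSpace ℝ (Fin l) → ℂ)
    (p : EuclideanSpace ℝ (Fin k) × EuclideanSpace ℝ (Fin l)) : ℂ :=
  fderiv ℝ (fun X => f (X, p.2)) p.1 (H.J (EuclideanSpace.single α (1 : ℝ)) p.1)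

/-- The compound angular momentum operator `ℳ = ∑_α ∂_{Z_α} ∘ D_α`. -/
def Mop {k l : ℕ} (H : HType k l)
    (f : EuclideanSpace ℝ (Fin k) × EuclideanSpace ℝ (Fin l) → ℂ)
    (p : EuclideanSpace ℝ (Fin k) × EuclideanSpace ℝ (Fin l)) : ℂ :=
  ∑ α : Fin l,
    fderiv ℝ (fun Z => Dop H α f (p.1, Z)) p.2 (EuclideanSpace.single α (1 : ℝ))

/-- The twisted Z-Fourier transform of `φ` with polynomial weight `Θ_Q^p Θ̄_Q^q`:
`F(X,Z) = ∫_{ℝ^l} e^{i⟨Z,V⟩} φ(V) Θ_Q(X,V/‖V‖)^p Θ̄_Q(X,V/‖V‖)^q dV`. -/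
def twistedFourier {k l : ℕ} (H : HType k l) (Q : EuclideanSpace ℝ (Fin k)) (p q : ℕ)
    (φ : EuclideanSpace ℝ (Fin l) → ℂ)
    (w : EuclideanSpace ℝ (Fin k) × EuclideanSpace ℝ (Fin l)) : ℂ :=
  ∫ V : EuclideanSpace ℝ (Fin l),
    Complex.exp (Complex.I * ((⟪w.2, V⟫ : ℝ) : ℂ)) * φ V *
      Theta H Q (‖V‖⁻¹ • V) w.1 ^ p *
      ((starRingEnd ℂ) (Theta H Q (‖V‖⁻¹ • V) w.1)) ^ q

/-- An integrable weight `a` times a continuous function of `s v`, where `s` stays in a compact set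
on the support of `a`, is integrable. -/
theorem MeasureTheory.Integrable.smul_continuous_comp {V W B : Type*} [MeasurableSpace V]
    {μ : Measure V} [TopologicalSpace W] [SecondCountableTopology W]
    [MeasurableSpace W] [OpensMeasurableSpace W]
    [NormedAddCommGroup B] [NormedSpace ℂ B]
    {a : V → ℂ} (ha : Integrable a μ) {s : V → W} (hs : Measurable s) {K : Set W}
    (hK : IsCompact K) (hsK : ∀ v, a v ≠ 0 → s v ∈ K) {g : W → B} (hg : Continuous g) :
    Integrable (fun v => a v • g (s v)) μ := by
  obtain ⟨C, hC⟩ := hK.exists_bound_of_continuousOn hg.continuousOn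
  have hmeas : AEStronglyMeasurable (fun v => g (s v)) μ :=
    (hg.stronglyMeasurable.comp_measurable hs).aestronglyMeasurable
  refine (ha.norm.mul_const C).mono' (ha.aestronglyMeasurable.smul hmeas) (.of_forall fun v => ?_)
  by_cases hv : a v = 0
  · simp [hv]
  · rw [norm_smul]
    exact mul_le_mul_of_nonneg_left (hC _ (hsK v hv)) (norm_nonneg _)

/-- Differentiation under the integral sign for integrands `a v * P (s v) x`, where the derivative of `P w` is jointly
continuous and `s` stays in a compact set on the support of `a`. -/
theorem hasFDerivAt_integral_mul_comp {V W E : Type*} [MeasurableSpace V]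
    {μ : Measure V} [TopologicalSpace W] [SecondCountableTopology W]
    [MeasurableSpace W] [OpensMeasurableSpace W]
    [NormedAddCommGroup E] [NormedSpace ℝ E] [FiniteDimensional ℝ E]
    {a : V → ℂ} (ha : Integrable a μ) {s : V → W} (hs : Measurable s) {K : Set W}
    (hK : IsCompact K) (hsK : ∀ v, a v ≠ 0 → s v ∈ K)
    {P : W → E → ℂ} {P' : W → E → E →L[ℝ] ℂ}
    (hP : ∀ x, Continuous fun w => P w x) (hP' : Continuous fun y : W × E => P' y.1 y.2)
    (hd : ∀ w x, HasFDerivAt (P w) (P' w x) x) (x : E) :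
    HasFDerivAt (fun x => ∫ v, a v * P (s v) x ∂μ) (∫ v, a v • P' (s v) x ∂μ) x := by
  have : ProperSpace E := FiniteDimensional.proper_real E
  obtain ⟨C, hC⟩ := (hK.prod (isCompact_closedBall x 1)).exists_bound_of_continuousOn
    hP'.continuousOn
  have hint (x : E) : Integrable (fun v => a v * P (s v) x) μ :=
    ha.smul_continuous_comp hs hK hsK (hP x)
  refine hasFDerivAt_integral_of_dominated_of_fderiv_le (𝕜 := ℝ)
    (F' := fun x v => a v • P' (s v) x) (bound := fun v => ‖a v‖ * C)
    (Metric.closedBall_mem_nhds x one_pos)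
    (.of_forall fun y => (hint y).aestronglyMeasurable) (hint x)
    (ha.smul_continuous_comp hs hK hsK (g := fun w => P' w x) (by fun_prop)).aestronglyMeasurable
    (.of_forall fun v y hy => ?_) (ha.norm.mul_const C)
    (.of_forall fun v y _ => (hd (s v) y).const_mul (a v))
  by_cases hv : a v = 0
  · simp [hv]
  · rw [norm_smul]
    exact mul_le_mul_of_nonneg_left (hC (s v, y) ⟨hsK v hv, hy⟩) (norm_nonneg _)

namespace HType

variable {k l : ℕ} (H : HType k l) (Q : EuclideanSpace ℝ (Fin k))

/-- `Theta` as a continuous real-linear map in `X`. -/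
def thetaCLM (u : EuclideanSpace ℝ (Fin l)) : EuclideanSpace ℝ (Fin k) →L[ℝ] ℂ :=
  Complex.ofRealCLM ∘L innerSL ℝ Q + Complex.I • (Complex.ofRealCLM ∘L innerSL ℝ (H.J u Q))

theorem thetaCLM_apply (u : EuclideanSpace ℝ (Fin l)) (X : EuclideanSpace ℝ (Fin k)) :
    H.thetaCLM Q u X = Theta H Q u X := by
  simp [thetaCLM, Theta]

theorem continuous_thetaCLM : Continuous (H.thetaCLM Q) := by
  have h : Continuous fun u => H.J u Q := (H.J.flip Q).continuous_of_finiteDimensional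
  unfold thetaCLM
  fun_prop

/-- The weight `Θ_Q^p Θ̄_Q^q`. -/
def weight (p q : ℕ) (u : EuclideanSpace ℝ (Fin l)) (X : EuclideanSpace ℝ (Fin k)) : ℂ :=
  H.thetaCLM Q u X ^ p * (starRingEnd ℂ (H.thetaCLM Q u X)) ^ q

/-- The derivative of the weight `Θ_Q^p Θ̄_Q^q` in `X`. -/
def weightDeriv (p q : ℕ) (u : EuclideanSpace ℝ (Fin l)) (X : EuclideanSpace ℝ (Fin k)) :
    EuclideanSpace ℝ (Fin k) →L[ℝ] ℂ :=
  (H.thetaCLM Q u X ^ p * (q * (starRingEnd ℂ (H.thetaCLM Q u X)) ^ (q - 1))) •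
      (Complex.conjCLE.toContinuousLinearMap ∘L H.thetaCLM Q u) +
    ((starRingEnd ℂ (H.thetaCLM Q u X)) ^ q * (p * H.thetaCLM Q u X ^ (p - 1))) •
      H.thetaCLM Q u

theorem continuous_weight (p q : ℕ) (X : EuclideanSpace ℝ (Fin k)) :
    Continuous fun u => H.weight Q p q u X := by
  have h := H.continuous_thetaCLM Q
  have hc := Complex.continuous_conj
  unfold weight
  fun_prop

theorem continuous_weightDeriv (p q : ℕ) :
    Continuous fun y : EuclideanSpace ℝ (Fin l) × EuclideanSpace ℝ (Fin k) =>
      H.weightDeriv Q p q y.1 y.2 := by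
  have h := H.continuous_thetaCLM Q
  have hc := Complex.continuous_conj
  unfold weightDeriv
  fun_prop

theorem hasFDerivAt_weight (p q : ℕ) (u : EuclideanSpace ℝ (Fin l))
    (X : EuclideanSpace ℝ (Fin k)) :
    HasFDerivAt (H.weight Q p q u) (H.weightDeriv Q p q u X) X := by
  have h := (H.thetaCLM Q u).hasFDerivAt (x := X)
  have hc := (Complex.conjCLE.toContinuousLinearMap ∘L H.thetaCLM Q u).hasFDerivAt (x := X)
  refine ((h.pow p).mul (hc.pow q)).congr_fderiv ?_
  ext Y
  simp [weightDeriv]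
  ring

theorem J_J_unit (V : EuclideanSpace ℝ (Fin l)) :
    H.J V (H.J (‖V‖⁻¹ • V) Q) = -‖V‖ • Q := by
  rcases eq_or_ne V 0 with rfl | hV
  · simp
  · have : ‖V‖ ≠ 0 := norm_ne_zero_iff.2 hV
    simp only [map_smul, LinearMap.smul_apply, H.clifford, smul_smul]
    congr 1
    field_simp

theorem thetaCLM_unit_J (V : EuclideanSpace ℝ (Fin l)) (X : EuclideanSpace ℝ (Fin k)) :
    H.thetaCLM Q (‖V‖⁻¹ • V) (H.J V X) =
      Complex.I * ‖V‖ * H.thetaCLM Q (‖V‖⁻¹ • V) X := by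
  have hskew (Y : EuclideanSpace ℝ (Fin k)) : ⟪Y, H.J V X⟫ = -⟪H.J V Y, X⟫ := by
    rw [H.skew, neg_neg]
  have hJ : H.J V Q = ‖V‖ • H.J (‖V‖⁻¹ • V) Q := by
    rcases eq_or_ne V 0 with rfl | hV
    · simp
    · rw [map_smul, LinearMap.smul_apply, smul_inv_smul₀ (norm_ne_zero_iff.2 hV)]
  rw [thetaCLM_apply, thetaCLM_apply, Theta, Theta, hskew, hskew, J_J_unit, hJ, inner_smul_left,
    inner_smul_left]
  push_cast
  simp only [conj_trivial, Complex.ofReal_neg]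
  linear_combination (-(‖V‖ : ℂ) * (⟪H.J (‖V‖⁻¹ • V) Q, X⟫ : ℝ)) * Complex.I_sq

/-- The weight `Θ_Q^p Θ̄_Q^q` is an eigenfunction of the rotation field `X ↦ J_V X`. -/
theorem weightDeriv_unit_J (p q : ℕ) (V : EuclideanSpace ℝ (Fin l))
    (X : EuclideanSpace ℝ (Fin k)) :
    H.weightDeriv Q p q (‖V‖⁻¹ • V) X (H.J V X) =
      Complex.I * (p - q) * ‖V‖ * H.weight Q p q (‖V‖⁻¹ • V) X := by
  have hpow (n : ℕ) (z : ℂ) : (n : ℂ) * z ^ (n - 1) * z = n * z ^ n := by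
    cases n <;> simp [pow_succ, mul_assoc]
  simp only [weightDeriv, weight, add_apply, smul_apply,
    ContinuousLinearMap.comp_apply, ContinuousLinearEquiv.coe_coe, Complex.conjCLE_apply,
    thetaCLM_unit_J, map_mul, Complex.conj_I, Complex.conj_ofReal, smul_eq_mul]
  linear_combination
    -Complex.I * ‖V‖ * H.thetaCLM Q (‖V‖⁻¹ • V) X ^ p *
        hpow q (starRingEnd ℂ (H.thetaCLM Q (‖V‖⁻¹ • V) X)) +
      Complex.I * ‖V‖ * (starRingEnd ℂ (H.thetaCLM Q (‖V‖⁻¹ • V) X)) ^ q *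
        hpow p (H.thetaCLM Q (‖V‖⁻¹ • V) X)

theorem sum_coord_smul_J (V : EuclideanSpace ℝ (Fin l)) (X : EuclideanSpace ℝ (Fin k)) :
    ∑ α, V α • H.J (EuclideanSpace.single α (1 : ℝ)) X = H.J V X := by
  conv_rhs => rw [← (EuclideanSpace.basisFun (Fin l) ℝ).sum_repr V]
  simp

theorem twistedFourier_eq (p q : ℕ) (φ : EuclideanSpace ℝ (Fin l) → ℂ)
    (X : EuclideanSpace ℝ (Fin k)) (Z : EuclideanSpace ℝ (Fin l)) :
    twistedFourier H Q p q φ (X, Z) =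
      ∫ V, (Complex.exp (Complex.I * ((⟪Z, V⟫ : ℝ) : ℂ)) * φ V) *
        H.weight Q p q (‖V‖⁻¹ • V) X := by
  simp only [twistedFourier, weight, thetaCLM_apply, mul_assoc]

theorem unit_mem_closedBall {E : Type*} [NormedAddCommGroup E] [NormedSpace ℝ E] (V : E) :
    ‖V‖⁻¹ • V ∈ Metric.closedBall (0 : E) 1 := by
  rw [mem_closedBall_zero_iff, norm_smul, norm_inv, norm_norm]
  exact inv_mul_le_one

theorem measurable_unit :
    Measurable fun V : EuclideanSpace ℝ (Fin l) => ‖V‖⁻¹ • V := by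
  fun_prop

theorem Dop_twistedFourier (p q : ℕ) {φ : EuclideanSpace ℝ (Fin l) → ℂ}
    (hφ : Continuous φ) (hφs : HasCompactSupport φ) (α : Fin l)
    (X : EuclideanSpace ℝ (Fin k)) (Z : EuclideanSpace ℝ (Fin l)) :
    Dop H α (twistedFourier H Q p q φ) (X, Z) =
      ∫ V, (φ V * H.weightDeriv Q p q (‖V‖⁻¹ • V) X (H.J (EuclideanSpace.single α 1) X)) *
        Complex.exp (Complex.I * ((⟪Z, V⟫ : ℝ) : ℂ)) := by
  have ha : Integrable
      (fun V => Complex.exp (Complex.I * ((⟪Z, V⟫ : ℝ) : ℂ)) * φ V) :=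
    Continuous.integrable_of_hasCompactSupport (by fun_prop) hφs.mul_left
  have hK := isCompact_closedBall (0 : EuclideanSpace ℝ (Fin l)) 1
  have hcont := H.continuous_weightDeriv Q p q
  have hd := hasFDerivAt_integral_mul_comp ha measurable_unit hK
    (fun V _ => unit_mem_closedBall V) (H.continuous_weight Q p q) hcont
    (H.hasFDerivAt_weight Q p q) X
  have hint := ha.smul_continuous_comp measurable_unit hK (fun V _ => unit_mem_closedBall V)
    (g := fun u => H.weightDeriv Q p q u X) (by fun_prop)
  simp only [Dop, twistedFourier_eq]
  rw [hd.fderiv, ContinuousLinearMap.integral_apply hint]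
  congr with V
  simp only [smul_apply, smul_eq_mul]
  ring

theorem integrable_mul_weightDeriv (p q : ℕ) {φ : EuclideanSpace ℝ (Fin l) → ℂ}
    (hφ : Continuous φ) (hφs : HasCompactSupport φ) (X Y : EuclideanSpace ℝ (Fin k)) :
    Integrable fun V => φ V * H.weightDeriv Q p q (‖V‖⁻¹ • V) X Y := by
  have hcont := H.continuous_weightDeriv Q p q
  exact (hφ.integrable_of_hasCompactSupport hφs).smul_continuous_comp measurable_unit
    (isCompact_closedBall 0 1) (fun V _ => unit_mem_closedBall V)
    (g := fun u => H.weightDeriv Q p q u X Y) (by fun_prop)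

end HType

/-- The derivative in `Z` of the character `exp (i ⟨Z, V⟩)`. -/
def expInnerDeriv {E : Type*} [NormedAddCommGroup E] [InnerProductSpace ℝ E] (V Z : E) :
    E →L[ℝ] ℂ :=
  (Complex.exp (Complex.I * ((⟪Z, V⟫ : ℝ) : ℂ)) * Complex.I) •
    (Complex.ofRealCLM ∘L innerSL ℝ V)

theorem hasFDerivAt_exp_inner {E : Type*} [NormedAddCommGroup E] [InnerProductSpace ℝ E]
    (V Z : E) :
    HasFDerivAt (fun Z : E => Complex.exp (Complex.I * ((⟪Z, V⟫ : ℝ) : ℂ)))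
      (expInnerDeriv V Z) Z := by
  have h := ((Complex.ofRealCLM ∘L innerSL ℝ V).hasFDerivAt (x := Z)).const_mul Complex.I
  convert h.cexp using 1
  · ext Y
    simp [real_inner_comm]
  · ext Y
    simp [expInnerDeriv, real_inner_comm, mul_assoc]

theorem continuous_expInnerDeriv {E : Type*} [NormedAddCommGroup E] [InnerProductSpace ℝ E] :
    Continuous fun y : E × E => expInnerDeriv y.1 y.2 := by
  unfold expInnerDeriv
  fun_prop

/-- The compound angular momentum operator `ℳ = ∑_α ∂_{Z_α} ∘ D_α` applied to the
twisted Z-Fourier transform of `φ` is the twisted Z-Fourier transform of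
`(q-p)‖V‖φ`. -/
theorem Mop_twistedFourier {k l : ℕ} (H : HType k l)
    (Q : EuclideanSpace ℝ (Fin k)) (p q : ℕ)
    (φ : EuclideanSpace ℝ (Fin l) → ℂ) (hφ : Continuous φ) (hφs : HasCompactSupport φ)
    (X : EuclideanSpace ℝ (Fin k)) (Z : EuclideanSpace ℝ (Fin l)) :
    Mop H (twistedFourier H Q p q φ) (X, Z)
      = ∫ V : EuclideanSpace ℝ (Fin l),
          Complex.exp (Complex.I * ((⟪Z, V⟫ : ℝ) : ℂ)) *
            (((q : ℂ) - (p : ℂ)) * (‖V‖ : ℂ)) * φ V *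
            Theta H Q (‖V‖⁻¹ • V) X ^ p *
            ((starRingEnd ℂ) (Theta H Q (‖V‖⁻¹ • V) X)) ^ q := by
  have hcont := continuous_expInnerDeriv (E := EuclideanSpace ℝ (Fin l))
  have ha (α : Fin l) :=
    H.integrable_mul_weightDeriv Q p q hφ hφs X (H.J (EuclideanSpace.single α 1) X)
  have hsupp (α : Fin l) (V : EuclideanSpace ℝ (Fin l))
      (hV : φ V * H.weightDeriv Q p q (‖V‖⁻¹ • V) X (H.J (EuclideanSpace.single α 1) X) ≠ 0) :
      V ∈ tsupport φ :=
    subset_tsupport φ (left_ne_zero_of_mul hV)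
  have hint (α : Fin l) := (ha α).smul_continuous_comp measurable_id hφs.isCompact (hsupp α)
    (g := fun V => expInnerDeriv V Z) (by fun_prop)
  have hfderiv (α : Fin l) := (hasFDerivAt_integral_mul_comp (ha α) measurable_id hφs.isCompact
    (hsupp α) (P := fun V Z => Complex.exp (Complex.I * ((⟪Z, V⟫ : ℝ) : ℂ)))
    (fun _ => by fun_prop) hcont hasFDerivAt_exp_inner Z).fderiv
  simp only [id_eq] at hint hfderiv
  simp only [Mop, H.Dop_twistedFourier Q p q hφ hφs, hfderiv,
    ContinuousLinearMap.integral_apply (hint _)]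
  rw [← integral_finsetSum _ fun α _ => (hint α).apply_continuousLinearMap _]
  congr with V
  have hsum := H.weightDeriv_unit_J Q p q V X
  rw [← H.sum_coord_smul_J V X, map_sum] at hsum
  simp only [map_smul, Complex.real_smul] at hsum
  calc _ = φ V * Complex.exp (Complex.I * ((⟪Z, V⟫ : ℝ) : ℂ)) * Complex.I *
        ∑ α, (V α : ℂ) *
          H.weightDeriv Q p q (‖V‖⁻¹ • V) X (H.J (EuclideanSpace.single α 1) X) := by
        rw [Finset.mul_sum]
        refine Finset.sum_congr rfl fun α _ => ?_
        simp [expInnerDeriv, EuclideanSpace.inner_single_right]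
        ring
    _ = _ := by
        rw [hsum]
        simp only [HType.weight, H.thetaCLM_apply]
        linear_combination (φ V * Complex.exp (Complex.I * ((⟪Z, V⟫ : ℝ) : ℂ)) * (p - q) * ‖V‖ *
          (Theta H Q (‖V‖⁻¹ • V) X ^ p * (starRingEnd ℂ) (Theta H Q (‖V‖⁻¹ • V) X) ^ q)) *
          Complex.I_sq
end
end

section
/- Let φ: ℝ^l → ℂ be continuously differentiable with compact support, and let F(Z) := ∫_{ℝ^l} e^{i⟨Z,V⟩} φ(V) dV. Then for every Z ≠ 0, the radial derivative of F satisfies ∂_{‖Z‖} F(Z) := (d/dρ)|_{ρ=‖Z‖} F(ρ·Z/‖Z‖) = −‖Z‖^{−1} ∫_{ℝ^l} e^{i⟨Z,V⟩} ( ‖V‖·(∂_r φ)(V) + l·φ(V) ) dV, where (∂_r φ)(V) denotes the radial derivative of φ at V, i.e. (d/dt)|_{t=‖V‖} φ(t·V/‖V‖) for V ≠ 0. -/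
open scoped RealInnerProductSpace
open MeasureTheory

noncomputable section

/-- Integrating the Euler field: `∫ Dg(x) x = -dim E • ∫ g` for `g` of class `C¹` with compact
support. -/
theorem integral_fderiv_apply_self {E F : Type*} [NormedAddCommGroup E] [NormedSpace ℝ E]
    [FiniteDimensional ℝ E] [MeasurableSpace E] [BorelSpace E] (μ : Measure E)
    [μ.IsAddHaarMeasure] [NormedAddCommGroup F] [NormedSpace ℝ F]
    {g : E → F} (hg : ContDiff ℝ 1 g) (hgs : HasCompactSupport g) :
    ∫ x, fderiv ℝ g x x ∂μ = -((Module.finrank ℝ E : ℝ) • ∫ x, g x ∂μ) := by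
  let b := Module.finBasis ℝ E
  let c := fun i => LinearMap.toContinuousLinearMap (b.coord i)
  have hg' : Continuous (fderiv ℝ g) := hg.continuous_fderiv one_ne_zero
  have hint : ∀ i, Integrable (fun x => c i x • fderiv ℝ g x (b i)) μ := fun i =>
    ((c i).continuous.smul (hg'.clm_apply continuous_const)).integrable_of_hasCompactSupport
      ((hgs.fderiv_apply ℝ (b i)).smul_left)
  have hparts : ∀ i, ∫ x, c i x • fderiv ℝ g x (b i) ∂μ = -∫ x, g x ∂μ := by
    intro i
    have hd : ∀ x, fderiv ℝ (c i) x (b i) = 1 := fun x => by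
      rw [(c i).fderiv]
      simp [c]
    rw [integral_smul_fderiv_eq_neg_fderiv_smul_of_integrable]
    · simp only [hd, one_smul]
    · simpa only [hd, one_smul] using hg.continuous.integrable_of_hasCompactSupport hgs
    · exact hint i
    · exact ((c i).continuous.smul hg.continuous).integrable_of_hasCompactSupport hgs.smul_left
    · exact fun x _ => (c i).differentiableAt
    · exact fun x _ => hg.differentiable one_ne_zero x
  have hsum : ∀ x, fderiv ℝ g x x = ∑ i, c i x • fderiv ℝ g x (b i) := by
    intro x
    simpa [c, -Module.Basis.sum_repr] using (congrArg (fderiv ℝ g x) (b.sum_repr x)).symm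
  simp_rw [hsum]
  rw [integral_finsetSum _ fun i _ => hint i]
  simp [hparts, Nat.cast_smul_eq_nsmul]

/-- Radial derivative times radius is the derivative along the Euler field. -/
theorem norm_mul_deriv_radial {E : Type*} [NormedAddCommGroup E] [NormedSpace ℝ E]
    {φ : E → ℂ} {V : E} (hφ : DifferentiableAt ℝ φ V) :
    (‖V‖ : ℂ) * deriv (fun t : ℝ => φ (t • ‖V‖⁻¹ • V)) ‖V‖ = fderiv ℝ φ V V := by
  rcases eq_or_ne V 0 with rfl | hV
  · simp
  have hn : ‖V‖ ≠ 0 := norm_ne_zero_iff.mpr hV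
  have hline : HasDerivAt (fun t : ℝ => t • ‖V‖⁻¹ • V) (‖V‖⁻¹ • V) ‖V‖ := by
    simpa using (hasDerivAt_id ‖V‖).smul_const (‖V‖⁻¹ • V)
  have hφ' : HasFDerivAt φ (fderiv ℝ φ V) (‖V‖ • ‖V‖⁻¹ • V) := by
    rw [smul_inv_smul₀ hn]
    exact hφ.hasFDerivAt
  have hcomp : HasDerivAt (fun t : ℝ => φ (t • ‖V‖⁻¹ • V)) (fderiv ℝ φ V (‖V‖⁻¹ • V)) ‖V‖ :=
    hφ'.comp_hasDerivAt ‖V‖ hline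
  rw [hcomp.deriv, map_smul, Complex.real_smul, Complex.ofReal_inv,
    mul_inv_cancel_left₀ (Complex.ofReal_ne_zero.mpr hn)]

/-- Differentiation under the integral sign for an oscillatory integral with linear phase. -/
theorem hasDerivAt_integral_exp_mul {E : Type*} [TopologicalSpace E] [MeasurableSpace E]
    [OpensMeasurableSpace E] (μ : Measure E) [IsFiniteMeasureOnCompacts μ]
    {c : E → ℝ} (hc : Continuous c) {φ : E → ℂ} (hφ : Continuous φ)
    (hφs : HasCompactSupport φ) (r : ℝ) :
    HasDerivAt (fun ρ : ℝ => ∫ V, Complex.exp (Complex.I * ((ρ * c V : ℝ) : ℂ)) * φ V ∂μ)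
      (∫ V, Complex.exp (Complex.I * ((r * c V : ℝ) : ℂ)) * (Complex.I * c V) * φ V ∂μ) r := by
  have hint : ∀ ρ : ℝ,
      Integrable (fun V => Complex.exp (Complex.I * ((ρ * c V : ℝ) : ℂ)) * φ V) μ := fun ρ =>
    Continuous.integrable_of_hasCompactSupport (by fun_prop) hφs.mul_left
  have hint' : Integrable
      (fun V => Complex.exp (Complex.I * ((r * c V : ℝ) : ℂ)) * (Complex.I * c V) * φ V) μ :=
    Continuous.integrable_of_hasCompactSupport (by fun_prop) hφs.mul_left
  have hbound : Integrable (fun V => |c V| * ‖φ V‖) μ :=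
    Continuous.integrable_of_hasCompactSupport (by fun_prop) hφs.norm.mul_left
  refine (hasDerivAt_integral_of_dominated_loc_of_deriv_le
    (F' := fun ρ V => Complex.exp (Complex.I * ((ρ * c V : ℝ) : ℂ)) * (Complex.I * c V) * φ V)
    Filter.univ_mem (.of_forall fun ρ => (hint ρ).aestronglyMeasurable) (hint r)
    hint'.aestronglyMeasurable (.of_forall fun V ρ _ => ?_) hbound
    (.of_forall fun V ρ _ => ?_)).2
  · rw [norm_mul, norm_mul, norm_mul, mul_comm Complex.I (Complex.ofReal _),
      Complex.norm_exp_ofReal_mul_I]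
    simp
  · have h : HasDerivAt (fun ρ : ℝ => Complex.I * ((ρ * c V : ℝ) : ℂ)) (Complex.I * c V) ρ := by
      simpa using (((hasDerivAt_id ρ).mul_const (c V)).ofReal_comp).const_mul Complex.I
    exact h.cexp.mul_const (φ V)

/-- Radial derivative identity for the Z-Fourier transform
`F(Z) = ∫ e^{i⟨Z,V⟩} φ(V) dV` of a `C¹` compactly supported function:
`∂_{‖Z‖}F(Z) = -‖Z‖⁻¹ ∫ e^{i⟨Z,V⟩}(‖V‖ ∂_r φ(V) + l φ(V)) dV`,
where `∂_r φ` is the radial derivative of `φ`. -/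
theorem radial_deriv_fourier {l : ℕ}
    (φ : EuclideanSpace ℝ (Fin l) → ℂ)
    (hφ : ContDiff ℝ 1 φ) (hφs : HasCompactSupport φ)
    (Z : EuclideanSpace ℝ (Fin l)) (hZ : Z ≠ 0) :
    deriv (fun ρ : ℝ => ∫ V : EuclideanSpace ℝ (Fin l),
        Complex.exp (Complex.I * ((⟪ρ • ‖Z‖⁻¹ • Z, V⟫ : ℝ) : ℂ)) * φ V) ‖Z‖
      = -(‖Z‖ : ℂ)⁻¹ *
        ∫ V : EuclideanSpace ℝ (Fin l),
          Complex.exp (Complex.I * ((⟪Z, V⟫ : ℝ) : ℂ)) *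
            ((‖V‖ : ℂ) * deriv (fun t : ℝ => φ (t • ‖V‖⁻¹ • V)) ‖V‖
              + (l : ℂ) * φ V) := by
  have hn : ‖Z‖ ≠ 0 := norm_ne_zero_iff.mpr hZ
  have hφd : Differentiable ℝ φ := hφ.differentiable one_ne_zero
  have hφ' : Continuous (fderiv ℝ φ) := hφ.continuous_fderiv one_ne_zero
  have hφc : Continuous φ := hφ.continuous
  let e : EuclideanSpace ℝ (Fin l) → ℂ := fun V => Complex.exp (Complex.I * ((⟪Z, V⟫ : ℝ) : ℂ))
  have he : ContDiff ℝ 1 e :=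
    (contDiff_const.mul (Complex.ofRealCLM.contDiff.comp (contDiff_const.inner ℝ contDiff_id))).cexp
  have hec : Continuous e := he.continuous
  have hderiv := (hasDerivAt_integral_exp_mul volume
    (c := fun V : EuclideanSpace ℝ (Fin l) => ‖Z‖⁻¹ * ⟪Z, V⟫) (by fun_prop) hφc hφs ‖Z‖).deriv
  simp only [mul_inv_cancel_left₀ hn] at hderiv
  simp only [real_inner_smul_left, norm_mul_deriv_radial (hφd _)]
  rw [hderiv]
  have hprod : ∀ V, fderiv ℝ (fun V => e V * φ V) V V
      = e V * (Complex.I * ((⟪Z, V⟫ : ℝ) : ℂ)) * φ V + e V * fderiv ℝ φ V V := by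
    intro V
    have hlin : HasFDerivAt (fun V => Complex.I * ((⟪Z, V⟫ : ℝ) : ℂ))
        (Complex.I • Complex.ofRealCLM.comp (innerSL ℝ Z)) V :=
      (Complex.ofRealCLM.comp (innerSL ℝ Z)).hasFDerivAt.const_mul Complex.I
    have hmul : HasFDerivAt (fun V => e V * φ V) _ V := hlin.cexp.mul (hφd V).hasFDerivAt
    rw [hmul.fderiv]
    simp [e]
    ring
  have heuler := integral_fderiv_apply_self volume (he.mul hφ) (hφs.mul_left (f := e))
  simp only [hprod, finrank_euclideanSpace_fin] at heuler
  have hint₁ : Integrable (fun V => e V * (Complex.I * ((⟪Z, V⟫ : ℝ) : ℂ)) * φ V) :=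
    Continuous.integrable_of_hasCompactSupport (by fun_prop) hφs.mul_left
  have hint₂ : Integrable (fun V => e V * fderiv ℝ φ V V) :=
    (hec.mul (hφ'.clm_apply continuous_id)).integrable_of_hasCompactSupport
      (HasCompactSupport.mul_left ((hφs.fderiv ℝ).mono fun V hV h => hV (by simp [h])))
  have hint₃ : Integrable (fun V => (l : ℂ) * (e V * φ V)) :=
    Continuous.integrable_of_hasCompactSupport (by fun_prop) hφs.mul_left.mul_left
  rw [integral_add hint₁ hint₂] at heuler
  have hleft : ∀ V : EuclideanSpace ℝ (Fin l),
      Complex.exp (Complex.I * ((⟪Z, V⟫ : ℝ) : ℂ))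
          * (Complex.I * ((‖Z‖⁻¹ * ⟪Z, V⟫ : ℝ) : ℂ)) * φ V
        = (‖Z‖ : ℂ)⁻¹ * (e V * (Complex.I * ((⟪Z, V⟫ : ℝ) : ℂ)) * φ V) := fun V => by
    push_cast
    ring
  have hright : ∀ V : EuclideanSpace ℝ (Fin l),
      Complex.exp (Complex.I * ((⟪Z, V⟫ : ℝ) : ℂ)) * (fderiv ℝ φ V V + (l : ℂ) * φ V)
        = e V * fderiv ℝ φ V V + (l : ℂ) * (e V * φ V) := fun V => by
    ring
  simp_rw [hleft, hright]
  rw [integral_add hint₂ hint₃, integral_const_mul, integral_const_mul,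
    eq_sub_of_add_eq heuler, Complex.real_smul]
  push_cast
  ring
end
end

section
/- Let φ: ℝ^l → ℂ be twice continuously differentiable with compact support, and let F(Z) := ∫_{ℝ^l} e^{i⟨Z,V⟩} φ(V) dV. Then for every Z ≠ 0, the second radial derivative of F satisfies ∂²_{‖Z‖} F(Z) := (d²/dρ²)|_{ρ=‖Z‖} F(ρ·Z/‖Z‖) = ‖Z‖^{−2} ∫_{ℝ^l} e^{i⟨Z,V⟩} ( ‖V‖²·(∂_r² φ)(V) + 2(l+1)‖V‖·(∂_r φ)(V) + l(l+1)·φ(V) ) dV, where ∂_r φ and ∂_r² φ denote the first and second radial derivatives of φ, i.e. the derivatives of t ↦ φ(t·V/‖V‖) at t = ‖V‖ for V ≠ 0. -/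
open scoped RealInnerProductSpace
open MeasureTheory

noncomputable section

section EulerDerivative

variable {E : Type*} [NormedAddCommGroup E] [NormedSpace ℝ E]

/-- The Euler derivative `V ↦ Dψ(V) V`, which equals `‖V‖ ∂_r ψ(V)` away from the origin. -/
def eulerDeriv (ψ : E → ℂ) (V : E) : ℂ := fderiv ℝ ψ V V

theorem ContDiff.eulerDeriv {m n : WithTop ℕ∞} {ψ : E → ℂ} (hψ : ContDiff ℝ n ψ)
    (hmn : m + 1 ≤ n) : ContDiff ℝ m (eulerDeriv ψ) :=
  (hψ.fderiv_right hmn).clm_apply contDiff_id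

theorem HasCompactSupport.eulerDeriv {ψ : E → ℂ} (hψ : HasCompactSupport ψ) :
    HasCompactSupport (eulerDeriv ψ) :=
  (hψ.fderiv ℝ).mono fun V hV hzero => hV (by simp [_root_.eulerDeriv, hzero])

theorem hasDerivAt_comp_smul {ψ : E → ℂ} (hψ : Differentiable ℝ ψ) (w : E) (t : ℝ) :
    HasDerivAt (fun t : ℝ => ψ (t • w)) (fderiv ℝ ψ (t • w) w) t := by
  have h := (hasDerivAt_id t).smul_const w
  rw [one_smul] at h
  exact (hψ (t • w)).hasFDerivAt.comp_hasDerivAt t h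

theorem mul_deriv_comp_smul {ψ : E → ℂ} (hψ : Differentiable ℝ ψ) (w : E) (t : ℝ) :
    (t : ℂ) * deriv (fun t : ℝ => ψ (t • w)) t = eulerDeriv ψ (t • w) := by
  rw [(hasDerivAt_comp_smul hψ w t).deriv, eulerDeriv, map_smul, Complex.real_smul]

theorem sq_mul_iteratedDeriv_two_comp_smul {ψ : E → ℂ} (hψ : ContDiff ℝ 2 ψ) (w : E) (t : ℝ) :
    (t : ℂ) ^ 2 * iteratedDeriv 2 (fun t : ℝ => ψ (t • w)) t
      = eulerDeriv (eulerDeriv ψ) (t • w) - eulerDeriv ψ (t • w) := by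
  have hψ₁ : Differentiable ℝ ψ := hψ.differentiable (by norm_num)
  have hEψ : Differentiable ℝ (eulerDeriv ψ) :=
    (hψ.eulerDeriv (m := 1) (by norm_num)).differentiable (by norm_num)
  have hg : ContDiff ℝ 2 (fun t : ℝ => ψ (t • w)) := hψ.comp (contDiff_id.smul contDiff_const)
  have hdg : Differentiable ℝ (deriv fun t : ℝ => ψ (t • w)) :=
    (ContDiff.deriv' (n := 1) (by simpa [one_add_one_eq_two] using hg)).differentiable (by norm_num)
  have hmul := (Complex.ofRealCLM.hasDerivAt (x := t)).mul (hdg t).hasDerivAt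
  have heq : (⇑Complex.ofRealCLM * deriv fun t : ℝ => ψ (t • w))
      = fun t : ℝ => eulerDeriv ψ (t • w) :=
    funext fun t => mul_deriv_comp_smul hψ₁ w t
  rw [heq] at hmul
  rw [iteratedDeriv_succ, iteratedDeriv_one, ← mul_deriv_comp_smul hEψ, hmul.deriv,
    ← mul_deriv_comp_smul hψ₁]
  simp
  ring

theorem norm_mul_radial_deriv {ψ : E → ℂ} (hψ : Differentiable ℝ ψ) (V : E) :
    (‖V‖ : ℂ) * deriv (fun t : ℝ => ψ (t • ‖V‖⁻¹ • V)) ‖V‖ = eulerDeriv ψ V := by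
  rw [mul_deriv_comp_smul hψ]
  rcases eq_or_ne V 0 with rfl | hV
  · simp
  · rw [smul_inv_smul₀ (norm_ne_zero_iff.mpr hV)]

theorem norm_sq_mul_radial_iteratedDeriv_two {ψ : E → ℂ} (hψ : ContDiff ℝ 2 ψ) (V : E) :
    (‖V‖ : ℂ) ^ 2 * iteratedDeriv 2 (fun t : ℝ => ψ (t • ‖V‖⁻¹ • V)) ‖V‖
      = eulerDeriv (eulerDeriv ψ) V - eulerDeriv ψ V := by
  rw [sq_mul_iteratedDeriv_two_comp_smul hψ]
  rcases eq_or_ne V 0 with rfl | hV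
  · simp
  · rw [smul_inv_smul₀ (norm_ne_zero_iff.mpr hV)]

end EulerDerivative

section Dilation

variable {E : Type*} [NormedAddCommGroup E] [NormedSpace ℝ E] [FiniteDimensional ℝ E]
  [MeasurableSpace E] [BorelSpace E] (μ : Measure E) [μ.IsAddHaarMeasure]

theorem hasDerivAt_integral_mul_comp_smul {e ψ : E → ℂ} (he : Continuous e)
    (he_norm : ∀ V, ‖e V‖ ≤ 1) (hψ : ContDiff ℝ 1 ψ) (hψs : HasCompactSupport ψ)
    {u : ℝ} (hu : 0 < u) :
    HasDerivAt (fun u : ℝ => ∫ V, e V * ψ (u • V) ∂μ)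
      (∫ V, e V * fderiv ℝ ψ (u • V) V ∂μ) u := by
  have hfd : Continuous (fderiv ℝ ψ) := hψ.continuous_fderiv (by norm_num)
  have hEψ : Continuous (eulerDeriv ψ) := (hψ.eulerDeriv (m := 0) (by norm_num)).continuous
  obtain ⟨C, hC⟩ := hψs.eulerDeriv.exists_bound_of_continuous hEψ
  obtain ⟨R, hR⟩ := hψs.isCompact.isBounded.subset_closedBall (0 : E)
  have hcont (v : ℝ) : Continuous fun V => e V * ψ (v • V) :=
    he.mul (hψ.continuous.comp (continuous_const_smul v))
  refine (hasDerivAt_integral_of_dominated_loc_of_deriv_le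
    (bound := (Metric.closedBall (0 : E) (R / (u / 2))).indicator fun _ => C / (u / 2))
    (F' := fun v V => e V * fderiv ℝ ψ (v • V) V)
    (Ioi_mem_nhds (half_lt_self hu)) (.of_forall fun v => (hcont v).aestronglyMeasurable)
    ?_ ?_ (.of_forall fun V v hv => ?_) ?_ (.of_forall fun V v _ => ?_)).2
  · exact (hcont u).integrable_of_hasCompactSupport
      ((hψs.comp_homeomorph (Homeomorph.smulOfNeZero u hu.ne')).mul_left)
  · exact (he.mul ((hfd.comp (continuous_const_smul u)).clm_apply
      continuous_id)).aestronglyMeasurable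
  · have hv' : u / 2 < v := hv
    have hv₀ : 0 < v := (half_pos hu).trans hv'
    have hC₀ : 0 ≤ C := (norm_nonneg _).trans (hC 0)
    by_cases hV : V ∈ Metric.closedBall (0 : E) (R / (u / 2))
    · rw [Set.indicator_of_mem hV, norm_mul]
      have hE : fderiv ℝ ψ (v • V) V = v⁻¹ • eulerDeriv ψ (v • V) := by
        rw [eulerDeriv, map_smul, inv_smul_smul₀ hv₀.ne']
      calc ‖e V‖ * ‖fderiv ℝ ψ (v • V) V‖ ≤ 1 * ‖fderiv ℝ ψ (v • V) V‖ := by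
            gcongr; exact he_norm V
        _ = ‖eulerDeriv ψ (v • V)‖ / v := by
            rw [one_mul, hE, norm_smul, Real.norm_of_nonneg (inv_nonneg.mpr hv₀.le),
              div_eq_inv_mul]
        _ ≤ C / (u / 2) := by gcongr; exact hC _
    · have hnot : v • V ∉ tsupport ψ := fun hmem => hV <| by
        have hball := hR hmem
        rw [mem_closedBall_zero_iff] at hball ⊢
        rw [norm_smul, Real.norm_of_nonneg hv₀.le] at hball
        rw [le_div_iff₀ (half_pos hu), mul_comm]
        exact (mul_le_mul_of_nonneg_right hv'.le (norm_nonneg V)).trans hball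
      rw [Set.indicator_of_notMem hV, fderiv_of_notMem_tsupport ℝ hnot]
      simp
  · exact (integrable_indicator_iff measurableSet_closedBall).mpr
      (integrableOn_const (isCompact_closedBall _ _).measure_lt_top.ne)
  · exact (hasDerivAt_comp_smul (hψ.differentiable (by norm_num)) V v).const_mul (e V)

theorem integral_comp_smul_mul (e ψ : E → ℂ) {s : ℝ} (hs : 0 < s) :
    ∫ V, e (s • V) * ψ V ∂μ
      = ((s⁻¹ : ℝ) : ℂ) ^ Module.finrank ℝ E * ∫ V, e V * ψ (s⁻¹ • V) ∂μ := by
  have h := Measure.integral_comp_smul μ (fun V => e V * ψ (s⁻¹ • V)) s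
  simp only [inv_smul_smul₀ hs.ne'] at h
  rw [h, abs_of_pos (by positivity), Complex.real_smul]
  push_cast
  rw [inv_pow]

theorem hasDerivAt_integral_comp_smul_mul {e ψ : E → ℂ} (he : Continuous e)
    (he_norm : ∀ V, ‖e V‖ ≤ 1) (hψ : ContDiff ℝ 1 ψ) (hψs : HasCompactSupport ψ)
    {s : ℝ} (hs : 0 < s) :
    HasDerivAt (fun s : ℝ => ∫ V, e (s • V) * ψ V ∂μ)
      (-((s⁻¹ : ℝ) : ℂ) *
        ∫ V, e (s • V) * (Module.finrank ℝ E * ψ V + eulerDeriv ψ V) ∂μ) s := by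
  set d := Module.finrank ℝ E with hd
  have hEψ : Continuous (eulerDeriv ψ) := (hψ.eulerDeriv (m := 0) (by norm_num)).continuous
  have hinv : HasDerivAt (fun s : ℝ => s⁻¹) (-(s ^ 2)⁻¹) s := hasDerivAt_inv hs.ne'
  have hI := (hasDerivAt_integral_mul_comp_smul μ he he_norm hψ hψs
    (inv_pos.mpr hs)).scomp s hinv
  have hprod := (hinv.ofReal_comp.pow d).mul hI
  have hev : (fun s : ℝ => ∫ V, e (s • V) * ψ V ∂μ) =ᶠ[nhds s]
      fun s => ((s⁻¹ : ℝ) : ℂ) ^ d * ∫ V, e V * ψ (s⁻¹ • V) ∂μ :=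
    (lt_mem_nhds hs).mono fun s hs => integral_comp_smul_mul μ e ψ hs
  refine (hprod.congr_of_eventuallyEq hev).congr_deriv ?_
  have hint {χ : E → ℂ} (hχ : Continuous χ) (hχs : HasCompactSupport χ) :
      Integrable (fun V => e (s • V) * χ V) μ :=
    ((he.comp (continuous_const_smul s)).mul hχ).integrable_of_hasCompactSupport hχs.mul_left
  have hfd : ∫ V, e V * fderiv ℝ ψ (s⁻¹ • V) V ∂μ
      = s * ∫ V, e V * eulerDeriv ψ (s⁻¹ • V) ∂μ := by
    rw [← integral_const_mul]
    refine integral_congr_ae (.of_forall fun V => ?_)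
    have hs' : (s : ℂ) ≠ 0 := mod_cast hs.ne'
    simp only [eulerDeriv, map_smul, Complex.real_smul]
    push_cast
    field_simp
  have hsplit : ∫ V, e (s • V) * (d * ψ V + eulerDeriv ψ V) ∂μ
      = d * ∫ V, e (s • V) * ψ V ∂μ + ∫ V, e (s • V) * eulerDeriv ψ V ∂μ := by
    rw [← integral_const_mul, ← integral_add ((hint hψ.continuous hψs).const_mul _)
      (hint hEψ hψs.eulerDeriv)]
    congr 1 with V
    ring
  rw [hsplit, integral_comp_smul_mul μ e ψ hs, integral_comp_smul_mul μ e _ hs, hfd]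
  have hs' : (s : ℂ) ≠ 0 := mod_cast hs.ne'
  have hpow : (d : ℂ) * ((s⁻¹ : ℝ) : ℂ) ^ (d - 1) = d * ((s⁻¹ : ℝ) : ℂ) ^ d * s := by
    rcases Nat.eq_zero_or_pos d with h | h
    · simp [h]
    · obtain ⟨k, hk⟩ := Nat.exists_eq_succ_of_ne_zero h.ne'
      rw [hk, Nat.succ_sub_one, pow_succ]
      push_cast
      field_simp
  rw [hpow, Complex.real_smul, ← hd]
  simp only [Function.comp, Pi.pow_apply]
  push_cast
  field_simp
  ring

theorem iteratedDeriv_two_integral_comp_smul_mul {e φ : E → ℂ} (he : Continuous e)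
    (he_norm : ∀ V, ‖e V‖ ≤ 1) (hφ : ContDiff ℝ 2 φ) (hφs : HasCompactSupport φ)
    {s : ℝ} (hs : 0 < s) :
    iteratedDeriv 2 (fun s : ℝ => ∫ V, e (s • V) * φ V ∂μ) s
      = ((s : ℂ) ^ 2)⁻¹ * ∫ V, e (s • V) *
          ((eulerDeriv (eulerDeriv φ) V - eulerDeriv φ V)
            + 2 * ((Module.finrank ℝ E : ℂ) + 1) * eulerDeriv φ V
            + Module.finrank ℝ E * ((Module.finrank ℝ E : ℂ) + 1) * φ V) ∂μ := by
  set d := Module.finrank ℝ E with hd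
  have hφ₁ : ContDiff ℝ 1 φ := hφ.of_le (by norm_num)
  have hEφ : ContDiff ℝ 1 (eulerDeriv φ) := hφ.eulerDeriv (by norm_num)
  set ψ : E → ℂ := fun V => d * φ V + eulerDeriv φ V
  have hψ : ContDiff ℝ 1 ψ := (contDiff_const.mul hφ₁).add hEφ
  have hψs : HasCompactSupport ψ := hφs.mul_left.add hφs.eulerDeriv
  have hEψ : Continuous (eulerDeriv ψ) := (hψ.eulerDeriv (m := 0) (by norm_num)).continuous
  have hfirst : deriv (fun s : ℝ => ∫ V, e (s • V) * φ V ∂μ) =ᶠ[nhds s]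
      fun s => -((s⁻¹ : ℝ) : ℂ) * ∫ V, e (s • V) * ψ V ∂μ :=
    (lt_mem_nhds hs).mono fun s hs =>
      (hasDerivAt_integral_comp_smul_mul μ he he_norm hφ₁ hφs hs).deriv
  have hsecond := (hasDerivAt_inv hs.ne').ofReal_comp.neg.mul
    (hasDerivAt_integral_comp_smul_mul μ he he_norm hψ hψs hs)
  have hint {χ : E → ℂ} (hχ : Continuous χ) (hχs : HasCompactSupport χ) :
      Integrable (fun V => e (s • V) * χ V) μ :=
    ((he.comp (continuous_const_smul s)).mul hχ).integrable_of_hasCompactSupport hχs.mul_left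
  have hE (V : E) : eulerDeriv ψ V = d * eulerDeriv φ V + eulerDeriv (eulerDeriv φ) V := by
    have h := (((hφ₁.differentiable (by norm_num) V).hasFDerivAt).const_mul (d : ℂ)).add
      (hEφ.differentiable (by norm_num) V).hasFDerivAt
    have h' : fderiv ℝ ψ V = _ := h.fderiv
    simp [eulerDeriv, h']
  have hsum : ∫ V, e (s • V) *
          ((eulerDeriv (eulerDeriv φ) V - eulerDeriv φ V)
            + 2 * ((d : ℂ) + 1) * eulerDeriv φ V + d * ((d : ℂ) + 1) * φ V) ∂μ
      = ∫ V, e (s • V) * ψ V ∂μ + ∫ V, e (s • V) * (d * ψ V + eulerDeriv ψ V) ∂μ := by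
    rw [← integral_add (hint hψ.continuous hψs)
      (hint (χ := fun V => d * ψ V + eulerDeriv ψ V)
        ((continuous_const.mul hψ.continuous).add hEψ) (hψs.mul_left.add hψs.eulerDeriv))]
    congr 1 with V
    rw [hE]
    simp only [ψ]
    ring
  rw [iteratedDeriv_succ, iteratedDeriv_one, hfirst.deriv_eq, hsum]
  refine hsecond.deriv.trans ?_
  have hs' : (s : ℂ) ≠ 0 := mod_cast hs.ne'
  rw [← hd, Pi.neg_apply]
  push_cast
  field_simp

end Dilation

/-- Second radial derivative identity for the Z-Fourier transform
`F(Z) = ∫ e^{i⟨Z,V⟩} φ(V) dV` of a `C²` compactly supported function: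
`∂²_{‖Z‖}F(Z) = ‖Z‖⁻² ∫ e^{i⟨Z,V⟩}(‖V‖² ∂_r²φ(V) + 2(l+1)‖V‖ ∂_rφ(V) + l(l+1)φ(V)) dV`,
where `∂_r φ` and `∂_r² φ` are the first and second radial derivatives of `φ`. -/
theorem second_radial_deriv_fourier {l : ℕ}
    (φ : EuclideanSpace ℝ (Fin l) → ℂ)
    (hφ : ContDiff ℝ 2 φ) (hφs : HasCompactSupport φ)
    (Z : EuclideanSpace ℝ (Fin l)) (hZ : Z ≠ 0) :
    iteratedDeriv 2 (fun ρ : ℝ => ∫ V : EuclideanSpace ℝ (Fin l),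
        Complex.exp (Complex.I * ((⟪ρ • ‖Z‖⁻¹ • Z, V⟫ : ℝ) : ℂ)) * φ V) ‖Z‖
      = ((‖Z‖ : ℂ) ^ 2)⁻¹ *
        ∫ V : EuclideanSpace ℝ (Fin l),
          Complex.exp (Complex.I * ((⟪Z, V⟫ : ℝ) : ℂ)) *
            ((‖V‖ : ℂ) ^ 2 * iteratedDeriv 2 (fun t : ℝ => φ (t • ‖V‖⁻¹ • V)) ‖V‖
              + 2 * ((l : ℂ) + 1) * (‖V‖ : ℂ) *
                  deriv (fun t : ℝ => φ (t • ‖V‖⁻¹ • V)) ‖V‖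
              + (l : ℂ) * ((l : ℂ) + 1) * φ V) := by
  have he : Continuous fun V : EuclideanSpace ℝ (Fin l) =>
      Complex.exp (Complex.I * ((⟪‖Z‖⁻¹ • Z, V⟫ : ℝ) : ℂ)) := by fun_prop
  have he_norm (V : EuclideanSpace ℝ (Fin l)) :
      ‖Complex.exp (Complex.I * ((⟪‖Z‖⁻¹ • Z, V⟫ : ℝ) : ℂ))‖ ≤ 1 := by
    rw [mul_comm, Complex.norm_exp_ofReal_mul_I]
  have hmain := iteratedDeriv_two_integral_comp_smul_mul volume he he_norm hφ hφs
    (norm_pos_iff.mpr hZ)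
  have hinner (ρ : ℝ) (V : EuclideanSpace ℝ (Fin l)) :
      ⟪‖Z‖⁻¹ • Z, ρ • V⟫ = ⟪ρ • ‖Z‖⁻¹ • Z, V⟫ := by
    rw [real_inner_smul_right, real_inner_smul_left (‖Z‖⁻¹ • Z)]
  simp only [hinner, smul_inv_smul₀ (norm_ne_zero_iff.mpr hZ), finrank_euclideanSpace_fin] at hmain
  simp only [hmain, mul_assoc, norm_sq_mul_radial_iteratedDeriv_two hφ,
    norm_mul_radial_deriv (hφ.differentiable two_ne_zero)]
end
end
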